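/- If p : ℕ → ℤ is an infinite Gray code of a real number x, then x has a signed digit representation, i.e. there exists d : ℕ → ℤ with d n ∈ {-1, 0, 1} for all n and x = ∑' n, (d n : ℝ) / 2^(n+1). (Classical reading of Theorem 6.3: G ⊆ S, obtained from G ⊆ S₂ by erasing the concurrency operator.) -/

import Mathlib

noncomputable def tent (x : ℝ) : ℝ := 1 - 2 * |x|

def IsGrayCode (p : ℕ → ℤ) (x : ℝ) : Prop :=
  |x| ≤ 1 ∧ (∀ i, p i ∈ ({-1, 1} : Set ℤ)) ∧
    ∀ i, tent^[i] x ≠ 0 →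
      (0 < tent^[i] x → p i = 1) ∧ (tent^[i] x < 0 → p i = -1)

theorem abs_tent_le_one {x : ℝ} (hx : |x| ≤ 1) : |tent x| ≤ 1 := by
  have := abs_nonneg x
  rw [tent, abs_le]
  constructor <;> linarith

theorem abs_iterate_tent_le_one {x : ℝ} (hx : |x| ≤ 1) (n : ℕ) : |tent^[n] x| ≤ 1 := by
  induction n with
  | zero => simpa using hx
  | succ n ih =>
    rw [Function.iterate_succ_apply']
    exact abs_tent_le_one ih

/-- The `n`-th signed digit determined by a Gray code. -/
def grayDigit (p : ℕ → ℤ) (n : ℕ) : ℤ := (-1) ^ n * ∏ i ∈ Finset.range (n + 1), p i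

namespace IsGrayCode

variable {p : ℕ → ℤ} {x : ℝ}

theorem abs_eq_one (hp : IsGrayCode p x) (n : ℕ) : |p n| = 1 := by
  rcases hp.2.1 n with h | h
  · simp [h]
  · simp [Set.mem_singleton_iff.mp h]

theorem abs_prod_eq_one (hp : IsGrayCode p x) (n : ℕ) :
    |∏ i ∈ Finset.range n, p i| = 1 := by
  rw [Finset.abs_prod]
  exact Finset.prod_eq_one fun i _ => hp.abs_eq_one i

theorem abs_grayDigit (hp : IsGrayCode p x) (n : ℕ) : |grayDigit p n| = 1 := by
  rw [grayDigit, abs_mul, hp.abs_prod_eq_one, abs_pow]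
  simp

/-- A Gray code inverts the tent map along the orbit. -/
theorem iterate_tent_eq (hp : IsGrayCode p x) (n : ℕ) :
    tent^[n] x = p n * (1 - tent^[n + 1] x) / 2 := by
  rw [Function.iterate_succ_apply', tent]
  rcases lt_trichotomy (tent^[n] x) 0 with h | h | h
  · rw [(hp.2.2 n h.ne).2 h, abs_of_neg h]
    push_cast
    ring
  · simp [h]
  · rw [(hp.2.2 n h.ne').1 h, abs_of_pos h]
    push_cast
    ring

theorem eq_sum_add_remainder (hp : IsGrayCode p x) (n : ℕ) :
    x = ∑ i ∈ Finset.range n, (grayDigit p i : ℝ) / 2 ^ (i + 1) +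
      ((-1) ^ n * ∏ i ∈ Finset.range n, p i : ℤ) * tent^[n] x / 2 ^ n := by
  induction n with
  | zero => simp
  | succ n ih =>
    rw [hp.iterate_tent_eq n] at ih
    rw [Finset.sum_range_succ, grayDigit, Finset.prod_range_succ]
    refine ih.trans ?_
    push_cast
    field_simp
    ring

theorem hasSum_grayDigit (hp : IsGrayCode p x) :
    HasSum (fun n => (grayDigit p n : ℝ) / 2 ^ (n + 1)) x := by
  have hgeom : Filter.Tendsto (fun n : ℕ => (1 / 2 : ℝ) ^ n) Filter.atTop (nhds 0) :=
    tendsto_pow_atTop_nhds_zero_of_lt_one (by norm_num) (by norm_num)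
  have hnorm (n : ℕ) : ‖(grayDigit p n : ℝ) / 2 ^ (n + 1)‖ = 1 / 2 / 2 ^ n := by
    rw [Real.norm_eq_abs, abs_div, ← Int.cast_abs, hp.abs_grayDigit, pow_succ']
    simp [mul_comm, div_eq_mul_inv]
  rw [hasSum_iff_tendsto_nat_of_summable_norm
    (by simpa only [hnorm] using summable_geometric_two' 1)]
  refine tendsto_iff_norm_sub_tendsto_zero.mpr (squeeze_zero (fun _ => norm_nonneg _) ?_ hgeom)
  intro n
  rw [norm_sub_rev, Real.norm_eq_abs, sub_eq_iff_eq_add'.mpr (hp.eq_sum_add_remainder n),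
    abs_div, abs_mul, ← Int.cast_abs, abs_mul, hp.abs_prod_eq_one, abs_pow]
  simpa [div_eq_mul_inv] using abs_iterate_tent_le_one hp.1 n

end IsGrayCode

theorem gray_code_to_signed_digit (x : ℝ) (p : ℕ → ℤ) (hp : IsGrayCode p x) :
    ∃ d : ℕ → ℤ, (∀ n, d n ∈ ({-1, 0, 1} : Set ℤ)) ∧
      x = ∑' n : ℕ, (d n : ℝ) / 2 ^ (n + 1) := by
  refine ⟨grayDigit p, fun n => ?_, hp.hasSum_grayDigit.tsum_eq.symm⟩
  rcases (abs_eq zero_le_one).mp (hp.abs_grayDigit n) with h | h <;> simp [h]
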